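/- Let v > 0 be a real number and n = 2. For any γ_0, γ_1, γ_2 ∈ Φ(2,v), either det(γ_0, γ_1, γ_2) = 0 or there exist ε ∈ {1,−1}, an integer l, and a positive integer h such that det(γ_0, γ_1, γ_2) = ε · v^l · c_h. -/

import Mathlib

/-- The quantum integer `c_k`: `(v^k - v^(-k))/(v - v⁻¹)` if `v ≠ 1`, and `k` if `v = 1`. -/
noncomputable def qint (v : ℝ) (k : ℤ) : ℝ :=
  if v = 1 then (k : ℝ) else (v ^ k - v ^ (-k)) / (v - v⁻¹)

/-- The root `α_{i,j} = α_i + α_{i+1} + ⋯ + α_j` in coordinates. -/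
noncomputable def alphaIJ (n i j : ℕ) : Fin (n + 1) → ℝ :=
  fun l => if i ≤ (l : ℕ) ∧ (l : ℕ) ≤ j then 1 else 0

/-- The root `α'_{i,j} = α_0 + v(α_1 + ⋯ + α_{i-1}) + v⁻¹(α_{j+1} + ⋯ + α_n)` in coordinates. -/
noncomputable def alphaIJ' (n : ℕ) (v : ℝ) (i j : ℕ) : Fin (n + 1) → ℝ :=
  fun l => if (l : ℕ) = 0 then 1
    else if (l : ℕ) < i then v
    else if j < (l : ℕ) then v⁻¹
    else 0

/-- `Φ_{i,j}(n,v) = { η v^m (c_{k+1} α_{i,j} + c_k α'_{i,j}) | η = ±1, m, k ∈ ℤ }`. -/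
noncomputable def PhiIJ (n : ℕ) (v : ℝ) (i j : ℕ) : Set (Fin (n + 1) → ℝ) :=
  { x | ∃ (η : ℝ) (m k : ℤ), (η = 1 ∨ η = -1) ∧
      x = (η * v ^ m) • (qint v (k + 1) • alphaIJ n i j + qint v k • alphaIJ' n v i j) }

/-- The realized root system `Φ(n,v)` of affine type `Ã_n` with parameter `v`. -/
noncomputable def Phi (n : ℕ) (v : ℝ) : Set (Fin (n + 1) → ℝ) :=
  ⋃ (i : ℕ) (j : ℕ) (_ : 1 ≤ i) (_ : i ≤ j) (_ : j ≤ n), PhiIJ n v i j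

/-- The determinant of the square matrix whose `l`-th column is `γ l`. -/
noncomputable def detCols {n : ℕ} (γ : Fin n → Fin n → ℝ) : ℝ :=
  Matrix.det (Matrix.of fun i l => γ l i)

theorem qint_add (v : ℝ) (hv : 0 < v) (a b : ℤ) :
    qint v (a + b) = v ^ (-a) * qint v b + v ^ b * qint v a := by
  unfold qint
  split_ifs with h
  · subst h; push_cast; simp; ring
  · have h1 : v ≠ 0 := hv.ne'
    rw [neg_add, zpow_add₀ h1, zpow_add₀ h1]
    ring

theorem qint_neg (v : ℝ) (a : ℤ) : qint v (-a) = - qint v a := by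
  unfold qint
  split_ifs with h
  · push_cast; ring
  · rw [neg_neg]; ring

theorem qint_one (v : ℝ) (hv : 0 < v) : qint v 1 = 1 := by
  unfold qint
  split_ifs with h
  · simp
  · have h2 : v - v⁻¹ ≠ 0 := by
      intro h3
      have h4 : v * v = 1 := by
        have : v = v⁻¹ := by linarith
        nth_rewrite 2 [this]
        exact mul_inv_cancel₀ hv.ne'
      apply h
      nlinarith
    rw [zpow_neg, zpow_one]
    exact div_self h2

theorem qint_succ (v : ℝ) (hv : 0 < v) (k : ℤ) :
    qint v (k + 1) = v ^ (-k) + v * qint v k := by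
  rw [qint_add v hv, qint_one v hv, zpow_one]; ring

theorem qint_succ' (v : ℝ) (hv : 0 < v) (k : ℤ) :
    qint v (k + 1) = v ^ k + v⁻¹ * qint v k := by
  rw [add_comm, qint_add v hv, qint_one v hv, zpow_neg, zpow_one]; ring

theorem qint_sub (v : ℝ) (hv : 0 < v) (a b : ℤ) :
    qint v (b - a) = v ^ (-a) * qint v b - v ^ (-b) * qint v a := by
  have h1 := qint_add v hv a (-b)
  have : b - a = -(a + -b) := by ring
  rw [this, qint_neg, h1, qint_neg]; ring

def Good (v x : ℝ) : Prop :=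
  ∃ (ε : ℝ) (l h : ℤ), (ε = 1 ∨ ε = -1) ∧ x = ε * v ^ l * qint v h

theorem Good.neg {v x : ℝ} (h : Good v x) : Good v (-x) := by
  obtain ⟨ε, l, k, he, rfl⟩ := h
  exact ⟨-ε, l, k, by rcases he with rfl | rfl <;> simp, by ring⟩

theorem Good.smul {v x η : ℝ} (hv : 0 < v) (m : ℤ) (hη : η = 1 ∨ η = -1) (h : Good v x) :
    Good v (η * v ^ m * x) := by
  obtain ⟨ε, l, k, he, rfl⟩ := h
  refine ⟨η * ε, m + l, k, by rcases he with rfl | rfl <;> rcases hη with rfl | rfl <;> simp, ?_⟩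
  rw [zpow_add₀ hv.ne']; ring

/-- the determinant written out -/
def D (x y z : Fin 3 → ℝ) : ℝ :=
  x 0 * (y 1 * z 2 - y 2 * z 1) - x 1 * (y 0 * z 2 - y 2 * z 0) + x 2 * (y 0 * z 1 - y 1 * z 0)

theorem detCols_eq (γ : Fin 3 → Fin 3 → ℝ) : detCols γ = D (γ 0) (γ 1) (γ 2) := by
  simp only [detCols, D, Matrix.det_fin_three, Matrix.of_apply]; ring

theorem D_swap (x y z : Fin 3 → ℝ) : D y x z = - D x y z := by unfold D; ring

theorem D_rot (x y z : Fin 3 → ℝ) : D y z x = D x y z := by unfold D; ring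

theorem D_smul (a b c : ℝ) (x y z : Fin 3 → ℝ) :
    D (a • x) (b • y) (c • z) = a * (b * (c * D x y z)) := by
  simp only [D, Pi.smul_apply, smul_eq_mul]; ring

noncomputable def VA (v : ℝ) (k : ℤ) : Fin 3 → ℝ := ![qint v k, qint v (k + 1), v⁻¹ * qint v k]
noncomputable def VB (v : ℝ) (k : ℤ) : Fin 3 → ℝ := ![qint v k, v * qint v k, qint v (k + 1)]
noncomputable def VC (v : ℝ) (k : ℤ) : Fin 3 → ℝ := ![qint v k, qint v (k + 1), qint v (k + 1)]

inductive Core (v : ℝ) : (Fin 3 → ℝ) → Prop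
  | a (k : ℤ) : Core v (VA v k)
  | b (k : ℤ) : Core v (VB v k)
  | c (k : ℤ) : Core v (VC v k)

theorem Phi_core {v : ℝ} {x : Fin 3 → ℝ} (h : x ∈ Phi 2 v) :
    ∃ (η : ℝ) (m : ℤ) (y : Fin 3 → ℝ), (η = 1 ∨ η = -1) ∧ Core v y ∧ x = (η * v ^ m) • y := by
  simp only [Phi, Set.mem_iUnion] at h
  obtain ⟨i, j, h1, h2, h3, η, m, k, hη, rfl⟩ := h
  refine ⟨η, m, _, hη, ?_, rfl⟩
  have : (i = 1 ∧ j = 1) ∨ (i = 2 ∧ j = 2) ∨ (i = 1 ∧ j = 2) := by omega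
  rcases this with ⟨rfl, rfl⟩ | ⟨rfl, rfl⟩ | ⟨rfl, rfl⟩
  · convert Core.a k using 1
    funext l
    fin_cases l <;> simp [alphaIJ, alphaIJ', VA, mul_comm]
  · convert Core.b k using 1
    funext l
    fin_cases l <;> simp [alphaIJ, alphaIJ', VB, mul_comm]
  · convert Core.c k using 1
    funext l
    fin_cases l <;> simp [alphaIJ, alphaIJ', VC]

theorem Good.zero (v : ℝ) : Good v 0 := ⟨1, 0, 0, by simp, by simp [qint]⟩

theorem good_AA (v : ℝ) (hv : 0 < v) (k l : ℤ) {z : Fin 3 → ℝ} (hz : Core v z) :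
    Good v (D (VA v k) (VA v l) z) := by
  rcases hz with m | m | m
  · convert Good.zero v using 1
    simp [D, VA]; ring
  all_goals
    refine ⟨-1, m, l - k, by simp, ?_⟩
    rw [qint_sub v hv]
    simp [D, VA, VB, VC, qint_succ v hv k, qint_succ v hv l, qint_succ' v hv m]
    ring

theorem good_BB (v : ℝ) (hv : 0 < v) (k l : ℤ) {z : Fin 3 → ℝ} (hz : Core v z) :
    Good v (D (VB v k) (VB v l) z) := by
  rcases hz with m | m | m
  rotate_left
  · convert Good.zero v using 1
    simp [D, VB]; ring
  all_goals
    refine ⟨1, -m, l - k, by simp, ?_⟩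
    rw [qint_sub v hv]
    simp [D, VA, VB, VC, qint_succ v hv k, qint_succ v hv l, qint_succ v hv m]
    ring

theorem good_CC (v : ℝ) (hv : 0 < v) (k l : ℤ) {z : Fin 3 → ℝ} (hz : Core v z) :
    Good v (D (VC v k) (VC v l) z) := by
  rcases hz with m | m | m
  · refine ⟨1, m, l - k, by simp, ?_⟩
    rw [qint_sub v hv]
    simp [D, VA, VC, qint_succ v hv k, qint_succ v hv l, qint_succ' v hv m]
    ring
  · refine ⟨-1, -m, l - k, by simp, ?_⟩
    rw [qint_sub v hv]
    simp [D, VB, VC, qint_succ v hv k, qint_succ v hv l, qint_succ v hv m]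
    ring
  · convert Good.zero v using 1
    simp [D, VC]

theorem good_ABC (v : ℝ) (hv : 0 < v) (k l m : ℤ) :
    Good v (D (VA v k) (VB v l) (VC v m)) := by
  refine ⟨-1, 0, k + (l - m), by simp, ?_⟩
  have h1 : D (VA v k) (VB v l) (VC v m) = 
      - (qint v k * (v ^ l * v ^ (-m)) + v ^ (-k) * (qint v l * v ^ m - v ^ l * qint v m)) := by
    have e : D (VA v k) (VB v l) (VC v m) =
      D ![qint v k, v ^ (-k) + v * qint v k, v⁻¹ * qint v k]
        ![qint v l, v * qint v l, v ^ l + v⁻¹ * qint v l]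
        ![qint v m, v ^ (-m) + v * qint v m, v ^ m + v⁻¹ * qint v m] := by
      rw [← qint_succ v hv, ← qint_succ v hv, ← qint_succ' v hv, ← qint_succ' v hv]; rfl
    rw [e]
    simp [D]; ring
  have h2 := qint_sub v hv (-l) (-m)
  have h3 : -m - -l = l - m := by ring
  rw [h3, qint_neg, qint_neg, neg_neg, neg_neg] at h2
  rw [h1, qint_add v hv k, h2, zpow_sub₀ hv.ne', zpow_neg v m]
  simp
  ring

attribute [irreducible] VA VB VC D

theorem good_core (v : ℝ) (hv : 0 < v) {x y z : Fin 3 → ℝ} (hx : Core v x) (hy : Core v y)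
    (hz : Core v z) : Good v (D x y z) := by
  have rot : ∀ {x y z}, Good v (D x y z) → Good v (D y z x) := fun h => by rwa [D_rot]
  have swp : ∀ {x y z}, Good v (D x y z) → Good v (D y x z) := fun h => by
    rw [D_swap]; exact h.neg
  have hx' := hx
  have hy' := hy
  rcases hx with k | k | k <;> rcases hy with l | l | l <;> rcases hz with m | m | m <;>
  first
  | exact good_AA v hv _ _ (by constructor)
  | exact good_BB v hv _ _ (by constructor)
  | exact good_CC v hv _ _ (by constructor)
  | exact rot (good_AA v hv m k hy')
  | exact rot (rot (good_AA v hv l m hx'))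
  | exact rot (good_BB v hv m k hy')
  | exact rot (rot (good_BB v hv l m hx'))
  | exact rot (good_CC v hv m k hy')
  | exact rot (rot (good_CC v hv l m hx'))
  | exact good_ABC v hv _ _ _
  | exact rot (good_ABC v hv _ _ _)
  | exact rot (rot (good_ABC v hv _ _ _))
  | exact swp (good_ABC v hv _ _ _)
  | exact swp (rot (good_ABC v hv _ _ _))
  | exact swp (rot (rot (good_ABC v hv _ _ _)))

/-- for any `γ_0, γ_1, γ_2 ∈ Φ(2,v)`, either `det(γ_0, γ_1, γ_2) = 0` or
`det(γ_0, γ_1, γ_2) = ε v^l c_h` with `ε = ±1`, `l ∈ ℤ` and a positive integer `h`. -/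
theorem det_Phi_rank_two (v : ℝ) (hv : 0 < v)
    (γ : Fin 3 → Fin 3 → ℝ) (hγ : ∀ l, γ l ∈ Phi 2 v) :
    detCols γ = 0 ∨
    ∃ (ε : ℝ) (l : ℤ) (h : ℤ), (ε = 1 ∨ ε = -1) ∧ 0 < h ∧
      detCols γ = ε * v ^ l * qint v h := by
  obtain ⟨η0, m0, y0, h0, c0, e0⟩ := Phi_core (hγ 0)
  obtain ⟨η1, m1, y1, h1, c1, e1⟩ := Phi_core (hγ 1)
  obtain ⟨η2, m2, y2, h2, c2, e2⟩ := Phi_core (hγ 2)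
  have key : Good v (detCols γ) := by
    rw [detCols_eq, e0, e1, e2, D_smul]
    exact ((((good_core v hv c0 c1 c2).smul hv m2 h2).smul hv m1 h1).smul hv m0 h0)
  obtain ⟨ε, l, h, he, hd⟩ := key
  rcases lt_trichotomy h 0 with hh | hh | hh
  · right
    refine ⟨-ε, l, -h, by rcases he with rfl | rfl <;> simp, by omega, ?_⟩
    rw [qint_neg, hd]; ring
  · left
    rw [hd, hh]; simp [qint]
  · exact Or.inr ⟨ε, l, h, he, hh, hd⟩
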